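/- The function f satisfies the transformation laws: f(x + 2πi) = f(x) for all x ∈ ℂ; and for every x ∈ ℂ with Φ(τ, x − α) ≠ 0 and Φ(τ, x + 2πiτ − α) ≠ 0 one has f(x + 2πiτ) = e^{−2πi/N} · f(x). -/

import Mathlib

open Complex

/-- `Φ(τ,x) = (1 − e^{−x}) ∏_{n≥1} (1 − qⁿe^{−x})(1 − qⁿeˣ)/(1 − qⁿ)²` with
`q = exp(2πiτ)`. -/
noncomputable def Phi (τ x : ℂ) : ℂ :=
  (1 - Complex.exp (-x)) *
    ∏' n : ℕ,
      ((1 - Complex.exp (2 * Real.pi * Complex.I * τ) ^ (n + 1) * Complex.exp (-x)) *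
        (1 - Complex.exp (2 * Real.pi * Complex.I * τ) ^ (n + 1) * Complex.exp x) /
        (1 - Complex.exp (2 * Real.pi * Complex.I * τ) ^ (n + 1)) ^ 2)

/-- The lattice `L(τ) = {2πi(mτ + n) : m, n ∈ ℤ}`. -/
def lat (τ : ℂ) : Set ℂ :=
  {z | ∃ m n : ℤ, z = 2 * Real.pi * Complex.I * (m * τ + n)}

/-- The normalized elliptic function `f` of level `N`:
`f(x) = Φ(τ,x)·Φ(τ,−α)/Φ(τ,x−α)` with `α = 2πi/N` (division by `0` yields `0`). -/
noncomputable def ellf (τ : ℂ) (N : ℕ) (x : ℂ) : ℂ :=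
  Phi τ x * Phi τ (-(2 * Real.pi * Complex.I / N)) /
    Phi τ (x - 2 * Real.pi * Complex.I / N)

/-- The extended reciprocal `1/f(x) = Φ(τ,x−α)/(Φ(τ,x)·Φ(τ,−α))`, with the
convention that a quotient with vanishing denominator is `0`. -/
noncomputable def invEllf (τ : ℂ) (N : ℕ) (x : ℂ) : ℂ :=
  Phi τ (x - 2 * Real.pi * Complex.I / N) /
    (Phi τ x * Phi τ (-(2 * Real.pi * Complex.I / N)))

lemma multipliable_one_sub_pow_mul {q : ℂ} (hq : ‖q‖ < 1) (u : ℂ) :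
    Multipliable fun n : ℕ ↦ 1 - q ^ (n + 1) * u := by
  have hs : Summable fun n : ℕ ↦ ‖-(q ^ (n + 1) * u)‖ := by
    simp only [norm_neg, norm_mul, norm_pow]
    exact ((summable_nat_add_iff 1).2
      (summable_geometric_of_lt_one (norm_nonneg q) hq)).mul_right _
  simpa [sub_eq_add_neg] using multipliable_one_add_of_summable hs

lemma tprod_one_sub_pow_ne_zero {q : ℂ} (hq : ‖q‖ < 1) :
    ∏' n : ℕ, (1 - q ^ (n + 1)) ≠ 0 := by
  simp only [sub_eq_add_neg]
  refine tprod_one_add_ne_zero_of_summable (fun n h ↦ ?_) ?_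
  · have h1 : q ^ (n + 1) = 1 := by linear_combination -h
    have h2 : ‖q‖ ^ (n + 1) < 1 := pow_lt_one₀ (norm_nonneg q) hq n.succ_ne_zero
    rw [← norm_pow, h1, norm_one] at h2
    exact lt_irrefl _ h2
  · simp only [norm_neg, norm_pow]
    exact (summable_nat_add_iff 1).2 (summable_geometric_of_lt_one (norm_nonneg q) hq)

/-- Splitting off the first factor of the `q`-Pochhammer product `∏ (1 − qⁿu)`. -/
lemma tprod_one_sub_pow_mul_eq {q : ℂ} (hq : ‖q‖ < 1) (u : ℂ) :
    ∏' n : ℕ, (1 - q ^ (n + 1) * u) =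
      (1 - q * u) * ∏' n : ℕ, (1 - q ^ (n + 1) * (q * u)) := by
  have h (n : ℕ) : 1 - q ^ (n + 1) * (q * u) = 1 - q ^ (n + 1 + 1) * u := by ring
  simp only [h]
  simpa using tprod_eq_zero_mul' (f := fun n : ℕ ↦ 1 - q ^ (n + 1) * u)
    ((multipliable_one_sub_pow_mul hq (q * u)).congr h)

lemma norm_exp_two_pi_I_mul_lt_one {τ : ℂ} (hτ : 0 < τ.im) :
    ‖Complex.exp (2 * Real.pi * Complex.I * τ)‖ < 1 :=
  UpperHalfPlane.norm_exp_two_pi_I_lt_one ⟨τ, hτ⟩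

/-- `Φ` as a quotient of three separately convergent products. -/
lemma Phi_eq_tprod {τ : ℂ} (hτ : 0 < τ.im) (x : ℂ) :
    Phi τ x = (1 - Complex.exp (-x)) *
      ((∏' n : ℕ, (1 - Complex.exp (2 * Real.pi * Complex.I * τ) ^ (n + 1) * Complex.exp (-x))) *
        (∏' n : ℕ, (1 - Complex.exp (2 * Real.pi * Complex.I * τ) ^ (n + 1) * Complex.exp x)) /
        (∏' n : ℕ, (1 - Complex.exp (2 * Real.pi * Complex.I * τ) ^ (n + 1))) ^ 2) := by
  have hq := norm_exp_two_pi_I_mul_lt_one hτ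
  have hm := multipliable_one_sub_pow_mul hq
  have hd : Multipliable fun n : ℕ ↦
      1 - Complex.exp (2 * Real.pi * Complex.I * τ) ^ (n + 1) := by simpa using hm 1
  rw [Phi, ← hd.tprod_pow, ← (hm _).tprod_mul (hm _), ← Multipliable.tprod_div₀]
  · exact (hm _).mul (hm _)
  · exact hd.pow 2
  · rw [hd.tprod_pow]
    exact pow_ne_zero 2 (tprod_one_sub_pow_ne_zero hq)

lemma Phi_add_two_pi_I (τ x : ℂ) : Phi τ (x + 2 * Real.pi * Complex.I) = Phi τ x := by
  simp [Phi, Complex.exp_add, Complex.exp_neg, Complex.exp_two_pi_mul_I]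

/-- `Φ(τ, x + 2πiτ) = −q⁻¹e^{−x} Φ(τ, x)`. -/
lemma Phi_add_two_pi_I_mul {τ : ℂ} (hτ : 0 < τ.im) (x : ℂ) :
    Phi τ (x + 2 * Real.pi * Complex.I * τ) =
      -Complex.exp (-(x + 2 * Real.pi * Complex.I * τ)) * Phi τ x := by
  have hq := norm_exp_two_pi_I_mul_lt_one hτ
  rw [Phi_eq_tprod hτ, Phi_eq_tprod hτ]
  have hy : Complex.exp (x + 2 * Real.pi * Complex.I * τ) =
      Complex.exp (2 * Real.pi * Complex.I * τ) * Complex.exp x := by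
    rw [Complex.exp_add, mul_comm]
  have hu : Complex.exp (2 * Real.pi * Complex.I * τ) *
      Complex.exp (-(x + 2 * Real.pi * Complex.I * τ)) = Complex.exp (-x) := by
    rw [← Complex.exp_add]; ring_nf
  have hyu : Complex.exp (-(x + 2 * Real.pi * Complex.I * τ)) *
      (Complex.exp (2 * Real.pi * Complex.I * τ) * Complex.exp x) = 1 := by
    rw [← hy, ← Complex.exp_add, neg_add_cancel, Complex.exp_zero]
  rw [tprod_one_sub_pow_mul_eq hq (Complex.exp (-(x + _))), hu, hy,
    tprod_one_sub_pow_mul_eq hq (Complex.exp x)]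
  linear_combination (-(1 - Complex.exp (-x)) *
    ((∏' n : ℕ, (1 - Complex.exp (2 * Real.pi * Complex.I * τ) ^ (n + 1) * Complex.exp (-x))) *
      (∏' n : ℕ, (1 - Complex.exp (2 * Real.pi * Complex.I * τ) ^ (n + 1) *
        (Complex.exp (2 * Real.pi * Complex.I * τ) * Complex.exp x))) /
      (∏' n : ℕ, (1 - Complex.exp (2 * Real.pi * Complex.I * τ) ^ (n + 1))) ^ 2)) * hyu

/-- Transformation laws for `f`: `f(x + 2πi) = f(x)`, and whenever the denominators
`Φ(τ, x − α)` and `Φ(τ, x + 2πiτ − α)` do not vanish,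
`f(x + 2πiτ) = e^{−2πi/N}·f(x)`. -/
theorem ellf_transformation (τ : ℂ) (hτ : 0 < τ.im) (N : ℕ) (hN : 2 ≤ N) :
    (∀ x : ℂ, ellf τ N (x + 2 * Real.pi * Complex.I) = ellf τ N x) ∧
    (∀ x : ℂ, Phi τ (x - 2 * Real.pi * Complex.I / N) ≠ 0 →
      Phi τ (x + 2 * Real.pi * Complex.I * τ - 2 * Real.pi * Complex.I / N) ≠ 0 →
      ellf τ N (x + 2 * Real.pi * Complex.I * τ) =
        Complex.exp (-(2 * Real.pi * Complex.I / N)) * ellf τ N x) := by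
  refine ⟨fun x ↦ ?_, fun x h _ ↦ ?_⟩
  · rw [ellf, ellf, Phi_add_two_pi_I, add_sub_right_comm, Phi_add_two_pi_I]
  · rw [ellf, ellf, add_sub_right_comm, Phi_add_two_pi_I_mul hτ, Phi_add_two_pi_I_mul hτ,
      show -(x + 2 * Real.pi * Complex.I * τ) = -(2 * Real.pi * Complex.I / N) +
        -(x - 2 * Real.pi * Complex.I / N + 2 * Real.pi * Complex.I * τ) by ring,
      Complex.exp_add]
    field_simp [h, Complex.exp_ne_zero]
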